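/- If m, n ≥ 3 with |m − n| ≥ 2, then the divisorial gonality of the toroidal grid graph T_{m,n} equals 2·min{m, n}. -/

import Mathlib

open SimpleGraph

/-- A tree decomposition of a graph `G`: a tree `tree` on node type `ι` with a bag of
vertices of `G` at each node, such that every vertex lies in some bag, both endpoints of
every edge lie in a common bag, and for each vertex the set of nodes whose bags contain it
induces a connected subgraph of the tree. -/
structure TreeDecomp {V : Type*} (G : SimpleGraph V) where
  ι : Type
  tree : SimpleGraph ι
  isTree : tree.IsTree
  bag : ι → Set V
  bag_cover : ∀ v : V, ∃ t, v ∈ bag t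
  bag_edge : ∀ ⦃u v : V⦄, G.Adj u v → ∃ t, u ∈ bag t ∧ v ∈ bag t
  bag_conn : ∀ v : V, (tree.induce {t | v ∈ bag t}).Connected

/-- The treewidth of `G`: the least `k` such that some tree decomposition of `G` has all
bags of size at most `k + 1` (i.e. the minimum over tree decompositions of one less than
the maximum bag size). -/
noncomputable def treewidth {V : Type*} (G : SimpleGraph V) : ℕ :=
  sInf {k : ℕ | ∃ D : TreeDecomp G, ∀ t, (D.bag t).ncard ≤ k + 1}

/-- Two vertex sets touch if their union induces a connected subgraph. -/
def Touches {V : Type*} (G : SimpleGraph V) (A B : Set V) : Prop :=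
  (G.induce (A ∪ B)).Connected

/-- A bramble: a family of vertex sets, each inducing a connected subgraph,
that pairwise touch. -/
structure IsBramble {V : Type*} (G : SimpleGraph V) (ℬ : Set (Set V)) : Prop where
  conn : ∀ B ∈ ℬ, (G.induce B).Connected
  touch : ∀ A ∈ ℬ, ∀ B ∈ ℬ, Touches G A B

/-- A strict bramble: a bramble any two of whose members share a vertex. -/
def IsStrictBramble {V : Type*} (G : SimpleGraph V) (ℬ : Set (Set V)) : Prop :=
  IsBramble G ℬ ∧ ∀ A ∈ ℬ, ∀ B ∈ ℬ, (A ∩ B).Nonempty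

/-- A hitting set for a family of vertex sets: a set meeting every member. -/
def IsHittingSet {V : Type*} (ℬ : Set (Set V)) (S : Set V) : Prop :=
  ∀ B ∈ ℬ, (S ∩ B).Nonempty

/-- The order of a bramble: the minimum size of a hitting set. -/
noncomputable def brambleOrder {V : Type*} (ℬ : Set (Set V)) : ℕ :=
  sInf {k : ℕ | ∃ S : Set V, IsHittingSet ℬ S ∧ S.ncard = k}

/-- The bramble number of `G`: the maximum order of a bramble on `G`. -/
noncomputable def brambleNumber {V : Type*} (G : SimpleGraph V) : ℕ :=
  sSup {k : ℕ | ∃ ℬ, IsBramble G ℬ ∧ brambleOrder ℬ = k}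

/-- The strict bramble number of `G`: the maximum order of a strict bramble on `G`. -/
noncomputable def strictBrambleNumber {V : Type*} (G : SimpleGraph V) : ℕ :=
  sSup {k : ℕ | ∃ ℬ, IsStrictBramble G ℬ ∧ brambleOrder ℬ = k}

/-- The `m × n` grid graph `P_m □ P_n`. -/
def gridGraph (m n : ℕ) : SimpleGraph (Fin m × Fin n) :=
  SimpleGraph.pathGraph m □ SimpleGraph.pathGraph n

/-- The stacked prism graph `Y_{m,n} = C_m □ P_n`. -/
def stackedPrism (m n : ℕ) : SimpleGraph (Fin m × Fin n) :=
  SimpleGraph.cycleGraph m □ SimpleGraph.pathGraph n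

/-- The toroidal grid graph `T_{m,n} = C_m □ C_n`. -/
def toroidalGrid (m n : ℕ) : SimpleGraph (Fin m × Fin n) :=
  SimpleGraph.cycleGraph m □ SimpleGraph.cycleGraph n

/-- `H` is a minor of `G`: there are pairwise disjoint nonempty connected branch sets in `G`,
one for each vertex of `H`, with an edge of `G` between the branch sets of any two vertices
adjacent in `H`. -/
def IsGraphMinor {W V : Type*} (H : SimpleGraph W) (G : SimpleGraph V) : Prop :=
  ∃ B : W → Set V,
    (∀ w, (B w).Nonempty) ∧
    (∀ w, (G.induce (B w)).Connected) ∧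
    (∀ w₁ w₂, w₁ ≠ w₂ → Disjoint (B w₁) (B w₂)) ∧
    (∀ ⦃w₁ w₂⦄, H.Adj w₁ w₂ → ∃ v₁ ∈ B w₁, ∃ v₂ ∈ B w₂, G.Adj v₁ v₂)

open Classical in
/-- The chip-firing move at a vertex `v`: `v` loses one chip along each incident edge,
each neighbor of `v` gains one chip. -/
noncomputable def fireVertex {V : Type*} (G : SimpleGraph V) (D : V → ℤ) (v : V) : V → ℤ :=
  fun u => if u = v then D u - (G.neighborSet v).ncard
    else if G.Adj v u then D u + 1 else D u

/-- Two divisors on `G` are equivalent if one is obtained from the other by a finite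
sequence of chip-firing moves. -/
def ChipEquiv {V : Type*} (G : SimpleGraph V) : (V → ℤ) → (V → ℤ) → Prop :=
  Relation.EqvGen (fun D D' => ∃ v, D' = fireVertex G D v)

/-- A divisor `D` wins the gonality game on `G` if for every vertex `q`, the divisor
`D - q` is equivalent to an effective divisor. -/
def WinsGonalityGame {V : Type*} [DecidableEq V] (G : SimpleGraph V) (D : V → ℤ) : Prop :=
  ∀ q : V, ∃ E : V → ℤ, (∀ v, 0 ≤ E v) ∧
    ChipEquiv G (fun v => D v - if v = q then 1 else 0) E

/-- The divisorial gonality of `G`: the least degree of an effective divisor winning the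
gonality game. -/
noncomputable def gonality {V : Type*} [Fintype V] [DecidableEq V] (G : SimpleGraph V) : ℕ :=
  sInf {k : ℕ | ∃ D : V → ℤ, (∀ v, 0 ≤ D v) ∧ (∑ v, D v) = (k : ℤ) ∧ WinsGonalityGame G D}


open Classical in
/-- The graph Laplacian of an integer-valued function on the vertices. -/
noncomputable def chipLaplacian {V : Type*} [Fintype V] (G : SimpleGraph V) (f : V → ℤ) (v : V) :
    ℤ :=
  ∑ w, if G.Adj v w then f v - f w else 0

section Laplacian

variable {V : Type*} [Fintype V] (G : SimpleGraph V)

theorem chipLaplacian_add (f g : V → ℤ) :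
    chipLaplacian G (f + g) = chipLaplacian G f + chipLaplacian G g := by
  classical
  ext v
  simp only [chipLaplacian, Pi.add_apply, ← Finset.sum_add_distrib]
  refine Finset.sum_congr rfl fun w _ => ?_
  split_ifs <;> ring

theorem chipLaplacian_neg (f : V → ℤ) : chipLaplacian G (-f) = -chipLaplacian G f := by
  classical
  ext v
  simp only [chipLaplacian, Pi.neg_apply, ← Finset.sum_neg_distrib]
  refine Finset.sum_congr rfl fun w _ => ?_
  split_ifs <;> ring

theorem chipLaplacian_const (c : ℤ) : chipLaplacian G (fun _ => c) = 0 := by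
  ext v
  simp [chipLaplacian]

theorem sum_chipLaplacian (f : V → ℤ) : ∑ v, chipLaplacian G f v = 0 := by
  classical
  have h : ∑ v, chipLaplacian G f v = -∑ v, chipLaplacian G f v := by
    conv_rhs => simp only [chipLaplacian]
    rw [Finset.sum_comm, ← Finset.sum_neg_distrib]
    refine Finset.sum_congr rfl fun v _ => ?_
    rw [chipLaplacian, ← Finset.sum_neg_distrib]
    refine Finset.sum_congr rfl fun w _ => ?_
    simp only [G.adj_comm w v]
    split_ifs <;> ring
  lia

theorem fireVertex_eq [DecidableEq V] (D : V → ℤ) (v : V) :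
    fireVertex G D v = D - chipLaplacian G (Pi.single v 1) := by
  classical
  ext u
  simp only [fireVertex, Pi.sub_apply, chipLaplacian]
  split_ifs with h1 h2
  · subst h1
    have : ∀ w, (if G.Adj u w then (Pi.single u 1 : V → ℤ) u - (Pi.single u 1 : V → ℤ) w else 0) =
        if w ∈ G.neighborSet u then 1 else 0 := by
      intro w
      by_cases hw : G.Adj u w
      · simp [hw, hw.ne']
      · simp [hw]
    simp only [this]
    rw [Set.ncard_eq_toFinset_card', Finset.sum_boole, Set.toFinset_card, Fintype.card_subtype]
  · rw [Finset.sum_eq_single v]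
    · simp [h1, h2.symm]
    · intro w _ hw
      simp [h1, hw]
    · simp
  · rw [Finset.sum_eq_zero]
    · simp
    · intro w _
      by_cases hw : w = v
      · subst hw
        simp [G.adj_comm u w, h2]
      · simp [h1, hw]

/-- Two divisors are equivalent exactly when they differ by the Laplacian of a function. -/
theorem chipEquiv_iff (D D' : V → ℤ) :
    ChipEquiv G D D' ↔ ∃ f : V → ℤ, D' = D - chipLaplacian G f := by
  classical
  constructor
  · intro h
    induction h with
    | rel D D' h =>
      obtain ⟨v, rfl⟩ := h
      exact ⟨_, fireVertex_eq G D v⟩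
    | refl D => exact ⟨fun _ => 0, by simp [chipLaplacian_const]⟩
    | symm D D' _ ih =>
      obtain ⟨f, rfl⟩ := ih
      exact ⟨-f, by simp [chipLaplacian_neg]⟩
    | trans D D' D'' _ _ ih₁ ih₂ =>
      obtain ⟨f, rfl⟩ := ih₁
      obtain ⟨g, rfl⟩ := ih₂
      exact ⟨f + g, by rw [chipLaplacian_add]; abel⟩
  · rintro ⟨f, rfl⟩
    let S : AddSubgroup (V → ℤ) :=
      { carrier := {f | ∀ D, ChipEquiv G D (D - chipLaplacian G f)}
        zero_mem' := fun D => by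
          have : chipLaplacian G 0 = 0 := chipLaplacian_const G 0
          rw [this, sub_zero]
          exact .refl _
        add_mem' := fun {f g} hf hg D => by
          rw [chipLaplacian_add, ← sub_sub]
          exact (hf D).trans _ _ _ (hg _)
        neg_mem' := fun {f} hf D => by
          have := hf (D - chipLaplacian G (-f))
          rw [chipLaplacian_neg, sub_neg_eq_add, add_sub_cancel_right] at this
          rw [chipLaplacian_neg, sub_neg_eq_add]
          exact this.symm }
    have hf : f ∈ S := by
      rw [← Finset.univ_sum_single f]
      refine S.sum_mem fun v _ => ?_
      have : (Pi.single v (f v) : V → ℤ) = f v • Pi.single v 1 := by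
        rw [← Pi.single_smul, smul_eq_mul, mul_one]
      rw [this]
      exact S.zsmul_mem (fun D => .rel _ _ ⟨v, (fireVertex_eq G D v).symm⟩) _
    exact hf D

theorem winsGonalityGame_iff [DecidableEq V] (D : V → ℤ) :
    WinsGonalityGame G D ↔
      ∀ q, ∃ f : V → ℤ, ∀ v, (if v = q then 1 else 0) ≤ D v - chipLaplacian G f v := by
  refine forall_congr' fun q => ⟨?_, ?_⟩
  · rintro ⟨E, hE, h⟩
    obtain ⟨f, rfl⟩ := (chipEquiv_iff G _ _).1 h
    refine ⟨f, fun v => ?_⟩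
    have := hE v
    simp only [Pi.sub_apply] at this
    lia
  · rintro ⟨f, hf⟩
    refine ⟨_, fun v => ?_, (chipEquiv_iff G _ _).2 ⟨f, rfl⟩⟩
    have := hf v
    simp only [Pi.sub_apply]
    lia

end Laplacian

section Scramble

variable {V : Type*} [Fintype V] (G : SimpleGraph V)

open Classical in
/-- The number of edges leaving a set of vertices. -/
noncomputable def edgeBoundaryCount (U : Set V) : ℤ :=
  ∑ v, ∑ w, if G.Adj v w then (if v ∈ U ∧ w ∉ U then 1 else 0) else 0

open Classical in
theorem edgeBoundaryCount_le (U : Set V) (D : V → ℤ) (hD : ∀ v, 0 ≤ D v)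
    (hD' : ∀ v, 0 ≤ D v - chipLaplacian G (U.indicator 1) v) :
    edgeBoundaryCount G U ≤ ∑ v, D v := by
  refine Finset.sum_le_sum fun v _ => ?_
  by_cases hv : v ∈ U
  · refine le_trans (le_of_eq ?_) (sub_nonneg.1 (hD' v))
    refine Finset.sum_congr rfl fun w _ => ?_
    by_cases hw : w ∈ U <;> simp [hv, hw]
  · simpa [hv] using hD v

theorem chipLaplacian_indicator_nonneg {U : Set V} {v : V} (hv : v ∈ U) :
    0 ≤ chipLaplacian G (U.indicator 1) v := by
  classical
  refine Finset.sum_nonneg fun w _ => ?_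
  by_cases hw : w ∈ U <;> simp [hv, hw]
  split_ifs <;> simp

theorem chipLaplacian_indicator_pos {U : Set V} {v w : V} (hv : v ∈ U) (hw : w ∉ U)
    (h : G.Adj v w) : 0 < chipLaplacian G (U.indicator 1) v := by
  classical
  refine Finset.sum_pos' (fun x _ => ?_) ⟨w, Finset.mem_univ _, by simp [hv, hw, h]⟩
  by_cases hx : x ∈ U <;> simp [hv, hx]
  split_ifs <;> simp

theorem chipLaplacian_indicator_compl (U : Set V) :
    chipLaplacian G (Uᶜ.indicator 1) = -chipLaplacian G (U.indicator 1) := by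
  rw [Set.indicator_compl, sub_eq_add_neg, chipLaplacian_add, chipLaplacian_neg]
  have : chipLaplacian G 1 = 0 := chipLaplacian_const G 1
  rw [this, zero_add]

/-- A scramble-type lower bound: if no set of fewer than `k` vertices meets all the eggs, and any
two eggs are separated only by cuts with at least `k` edges, then a winning effective divisor has
degree at least `k`. -/
theorem WinsGonalityGame.le_degree_of_scramble [DecidableEq V] {ι : Type*} [Fintype ι]
    (egg : ι → Set V) (k : ℕ) (hne : ∀ i, (egg i).Nonempty)
    (hconn : ∀ i (U : Set V), (egg i ∩ U).Nonempty → ¬ egg i ⊆ U →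
      ∃ x ∈ egg i ∩ U, ∃ y ∈ egg i \ U, G.Adj x y)
    (hhit : ∀ S : Finset V, S.card < k → ∃ i, ∀ v ∈ egg i, v ∉ S)
    (hcut : ∀ U : Set V, ∀ i j, egg i ⊆ U → Disjoint (egg j) U → (k : ℤ) ≤ edgeBoundaryCount G U)
    {D : V → ℤ} (hD : ∀ v, 0 ≤ D v) (hwin : WinsGonalityGame G D) :
    (k : ℤ) ≤ ∑ v, D v := by
  classical
  rw [winsGonalityGame_iff] at hwin
  by_contra! hlt
  -- Choose an equivalent effective divisor meeting as many eggs as possible.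
  let hits : (V → ℤ) → Finset ι := fun D => {i | ∃ v ∈ egg i, 0 < D v}
  have mem_hits : ∀ D i, i ∈ hits D ↔ ∃ v ∈ egg i, 0 < D v := fun D i => by simp [hits]
  obtain ⟨g, hg, hmax⟩ : ∃ g : V → ℤ, (∀ v, 0 ≤ D v - chipLaplacian G g v) ∧
      ∀ f : V → ℤ, (∀ v, 0 ≤ D v - chipLaplacian G f v) →
        (hits (D - chipLaplacian G f)).card ≤ (hits (D - chipLaplacian G g)).card := by
    obtain ⟨g, hg, h⟩ := exists_minimalFor_of_wellFoundedLT
      (fun f : V → ℤ => ∀ v, 0 ≤ D v - chipLaplacian G f v)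
      (fun f => Fintype.card ι - (hits (D - chipLaplacian G f)).card)
      ⟨fun _ => 0, by simpa [chipLaplacian_const] using hD⟩
    refine ⟨g, hg, fun f hf => ?_⟩
    have h₁ := Finset.card_le_univ (hits (D - chipLaplacian G f))
    have h₂ := Finset.card_le_univ (hits (D - chipLaplacian G g))
    by_contra! hlt'
    have := h hf (by dsimp only; lia)
    dsimp only at this
    lia
  set D₀ := D - chipLaplacian G g with hD₀
  have hsum : ∀ f, ∑ v, (D₀ - chipLaplacian G f) v = ∑ v, D v := fun f => by
    simp [hD₀, Finset.sum_sub_distrib, sum_chipLaplacian]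
  obtain ⟨e, he⟩ := hhit {v | 0 < D₀ v} (by
    have h₁ : ((Finset.card {v | 0 < D₀ v} : ℕ) : ℤ) ≤ ∑ v, D₀ v := by
      rw [Finset.card_filter]
      push_cast
      refine Finset.sum_le_sum fun v _ => ?_
      have : 0 ≤ D₀ v := hg v
      split_ifs <;> lia
    have h₂ := hsum (fun _ => 0)
    rw [chipLaplacian_const, sub_zero] at h₂
    lia)
  have he : e ∉ hits D₀ := by
    rw [mem_hits]
    rintro ⟨v, hv, h⟩
    exact he v hv (by simpa using h)
  obtain ⟨q, hq⟩ := hne e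
  obtain ⟨f, hf⟩ : ∃ f : V → ℤ, ∀ v, (if v = q then 1 else 0) ≤ D₀ v - chipLaplacian G f v := by
    obtain ⟨f, hf⟩ := hwin q
    refine ⟨f - g, fun v => ?_⟩
    have h₁ := hf v
    rw [sub_eq_add_neg f g, chipLaplacian_add, chipLaplacian_neg, hD₀]
    simp only [Pi.add_apply, Pi.neg_apply, Pi.sub_apply]
    lia
  -- Fire the superlevel sets of `f` one after the other, highest first.
  obtain ⟨M, hM⟩ : ∃ M : ℤ, ∀ v, f v ≤ M := by
    obtain ⟨M, hM⟩ := (Set.finite_range f).bddAbove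
    exact ⟨M, fun v => hM ⟨v, rfl⟩⟩
  obtain ⟨N, hN⟩ : ∃ N : ℕ, ∀ v, M - N ≤ f v := by
    obtain ⟨L, hL⟩ := (Set.finite_range f).bddBelow
    refine ⟨(M - L).toNat, fun v => ?_⟩
    have := hL ⟨v, rfl⟩
    lia
  let F : ℕ → V → ℤ := fun i => D₀ - chipLaplacian G (fun v => max (f v) (M - i))
  let U : ℕ → Set V := fun i => {v | M - i ≤ f v}
  have hF_nonneg : ∀ i v, 0 ≤ F i v := by
    intro i v
    rcases le_total (M - i) (f v) with h | h
    · have h₁ : chipLaplacian G (fun v => max (f v) (M - i)) v ≤ chipLaplacian G f v := by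
        classical
        refine Finset.sum_le_sum fun w _ => ?_
        dsimp only
        split_ifs <;> lia
      have h₂ := hf v
      have h₃ : (0 : ℤ) ≤ if v = q then 1 else 0 := by split_ifs <;> simp
      simp only [F, Pi.sub_apply]
      lia
    · have h₁ : chipLaplacian G (fun v => max (f v) (M - i)) v ≤ 0 := by
        classical
        refine Finset.sum_nonpos fun w _ => ?_
        dsimp only
        split_ifs <;> lia
      have h₂ : 0 ≤ D₀ v := hg v
      simp only [F, Pi.sub_apply]
      lia
  have hF_succ : ∀ i, F (i + 1) = F i - chipLaplacian G ((U i).indicator 1) := by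
    intro i
    have h₁ : (fun v => max (f v) (M - i)) =
        (fun v => max (f v) (M - (i + 1 : ℕ))) + (-((U i).indicator 1) + fun _ => 1) := by
      ext v
      have h₂ : (U i).indicator (1 : V → ℤ) v = if M - i ≤ f v then 1 else 0 := by
        simp [Set.indicator_apply, U]
      simp only [Pi.add_apply, Pi.neg_apply, h₂]
      split_ifs <;> lia
    simp only [F]
    rw [h₁, chipLaplacian_add, chipLaplacian_add, chipLaplacian_neg, chipLaplacian_const]
    abel
  have hU_mono : Monotone U := fun i j hij v (hv : M - i ≤ f v) => by
    change M - j ≤ f v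
    lia
  have hF_zero : F 0 = D₀ := by
    have : (fun v => max (f v) (M - (0 : ℕ))) = fun _ => M := by
      ext v
      simpa using hM v
    simp only [F]
    rw [this, chipLaplacian_const, sub_zero]
  have hF_N : e ∈ hits (F N) := by
    rw [mem_hits]
    refine ⟨q, hq, ?_⟩
    have : (fun v => max (f v) (M - N)) = f := by
      ext v
      simpa using hN v
    have h₁ := hf q
    simp only [F, this, Pi.sub_apply]
    simp only [if_true] at h₁
    lia
  -- The step at which the missed egg `e` is first hit.
  obtain ⟨i, hi, hi'⟩ : ∃ i, e ∉ hits (F i) ∧ e ∈ hits (F (i + 1)) := by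
    by_contra! h
    have : ∀ i, e ∉ hits (F i) := fun i => by
      induction i with
      | zero => rwa [hF_zero]
      | succ i ih => exact h i ih
    exact this N hF_N
  -- By maximality some egg `e'` hit at the start has been lost by then.
  obtain ⟨e', he'₀, he'₁⟩ : ∃ e', e' ∈ hits (F 0) ∧ e' ∉ hits (F (i + 1)) := by
    by_contra! h
    have h₁ : hits (F 0) ⊂ hits (F (i + 1)) := by
      refine Finset.ssubset_iff_subset_ne.2 ⟨h, fun heq => ?_⟩
      rw [← heq, hF_zero] at hi'
      exact he hi'
    have h₂ := Finset.card_lt_card h₁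
    have h₃ : F (i + 1) = D - chipLaplacian G (g + fun v => max (f v) (M - (i + 1 : ℕ))) := by
      rw [chipLaplacian_add, ← sub_sub]
    have h₄ := hmax _ (fun v => by
      have := hF_nonneg (i + 1) v
      rw [h₃] at this
      exact this)
    rw [← h₃, ← hF_zero] at h₄
    lia
  obtain ⟨j, hji, hj, hj'⟩ : ∃ j ≤ i, e' ∈ hits (F j) ∧ e' ∉ hits (F (j + 1)) := by
    by_contra! h
    have : ∀ j ≤ i + 1, e' ∈ hits (F j) := fun j => by
      induction j with
      | zero => exact fun _ => he'₀
      | succ j ih => exact fun hj => h j (by lia) (ih (by lia))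
    exact he'₁ (this _ le_rfl)
  have hzero : ∀ i e, e ∉ hits (F i) → ∀ v ∈ egg e, F i v = 0 := fun i e h v hv => by
    have := hF_nonneg i v
    by_contra hne
    exact h ((mem_hits _ _).2 ⟨v, hv, by lia⟩)
  have hsub : egg e' ⊆ U j := by
    obtain ⟨x, hx, hpos⟩ := (mem_hits _ _).1 hj
    have hxU : x ∈ U j := by
      by_contra hxU
      have h₁ := chipLaplacian_indicator_nonneg G (U := (U j)ᶜ) hxU
      have h₂ := hzero _ _ hj' x hx
      rw [chipLaplacian_indicator_compl, Pi.neg_apply] at h₁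
      rw [hF_succ, Pi.sub_apply] at h₂
      lia
    by_contra hsub
    obtain ⟨a, ⟨-, haU⟩, b, ⟨hb, hbU⟩, hab⟩ := hconn e' (U j) ⟨x, hx, hxU⟩ hsub
    have h₁ := chipLaplacian_indicator_pos G (U := (U j)ᶜ) hbU (by simpa using haU) hab.symm
    have h₂ := hzero _ _ hj' b hb
    have h₃ := hF_nonneg j b
    rw [chipLaplacian_indicator_compl, Pi.neg_apply] at h₁
    rw [hF_succ, Pi.sub_apply] at h₂
    lia
  have hdisj : Disjoint (egg e) (U i) := by
    obtain ⟨x, hx, hpos⟩ := (mem_hits _ _).1 hi'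
    have hxU : x ∉ U i := by
      intro hxU
      have h₁ := chipLaplacian_indicator_nonneg G hxU
      have h₂ := hzero _ _ hi x hx
      rw [hF_succ, Pi.sub_apply] at hpos
      lia
    rw [Set.disjoint_iff_inter_eq_empty, ← Set.not_nonempty_iff_eq_empty]
    intro hmeet
    obtain ⟨a, ⟨ha, haU⟩, b, ⟨-, hbU⟩, hab⟩ := hconn e (U i) hmeet fun h => hxU (h hx)
    have h₁ := chipLaplacian_indicator_pos G haU hbU hab
    have h₂ := hzero _ _ hi a ha
    have h₃ := hF_nonneg (i + 1) a
    rw [hF_succ, Pi.sub_apply] at h₃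
    lia
  have h₁ := hcut (U i) e' e (hsub.trans (hU_mono hji)) hdisj
  have h₂ := edgeBoundaryCount_le G (U i) (F i) (hF_nonneg i) fun v => by
    have := hF_nonneg (i + 1) v
    rwa [hF_succ] at this
  rw [hsum] at h₂
  lia

end Scramble

section BoxProd

variable {α β : Type*} [Fintype α] [Fintype β] (G : SimpleGraph α) (H : SimpleGraph β)

open Classical in
theorem sum_boxProd_adj (φ : α × β → ℤ) (a : α) (b : β) :
    ∑ w, (if (G □ H).Adj (a, b) w then φ w else 0) =
      ∑ a', (if G.Adj a a' then φ (a', b) else 0) + ∑ b', (if H.Adj b b' then φ (a, b') else 0) := by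
  have h : ∀ a' b', (if (G □ H).Adj (a, b) (a', b') then φ (a', b') else 0) =
      (if b = b' then (if G.Adj a a' then φ (a', b') else 0) else 0) +
        (if a = a' then (if H.Adj b b' then φ (a', b') else 0) else 0) := by
    intro a' b'
    by_cases ha : a = a' <;> by_cases hb : b = b' <;> simp [boxProd_adj, ha, hb]
  simp only [Fintype.sum_prod_type, h, Finset.sum_add_distrib]
  congr 1
  · simp
  · rw [Finset.sum_comm]
    simp

theorem chipLaplacian_boxProd (f : α × β → ℤ) (a : α) (b : β) :
    chipLaplacian (G □ H) f (a, b) =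
      chipLaplacian G (fun a' => f (a', b)) a + chipLaplacian H (fun b' => f (a, b')) b := by
  classical
  exact sum_boxProd_adj G H (fun w => f (a, b) - f w) a b

theorem edgeBoundaryCount_boxProd (U : Set (α × β)) :
    edgeBoundaryCount (G □ H) U =
      ∑ b, edgeBoundaryCount G {a | (a, b) ∈ U} + ∑ a, edgeBoundaryCount H {b | (a, b) ∈ U} := by
  classical
  simp only [edgeBoundaryCount, Fintype.sum_prod_type]
  rw [Finset.sum_comm (s := (Finset.univ : Finset β)), ← Finset.sum_add_distrib]
  refine Finset.sum_congr rfl fun a _ => ?_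
  rw [← Finset.sum_add_distrib]
  refine Finset.sum_congr rfl fun b _ => ?_
  have := sum_boxProd_adj G H (fun w => if (a, b) ∈ U ∧ w ∉ U then 1 else 0) a b
  rw [Fintype.sum_prod_type] at this
  exact this

variable [DecidableEq α] [DecidableEq β]

theorem WinsGonalityGame.comp_fst {D : α → ℤ} (h : WinsGonalityGame G D) :
    WinsGonalityGame (G □ H) (D ∘ Prod.fst) := by
  rw [winsGonalityGame_iff] at h ⊢
  rintro ⟨a₀, b₀⟩
  obtain ⟨f, hf⟩ := h a₀
  refine ⟨f ∘ Prod.fst, fun ⟨a, b⟩ => le_trans ?_ ((hf a).trans_eq ?_)⟩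
  · simp only [Prod.mk.injEq]
    split_ifs <;> simp_all
  · simp [chipLaplacian_boxProd, chipLaplacian_const]

theorem WinsGonalityGame.comp_snd {D : β → ℤ} (h : WinsGonalityGame H D) :
    WinsGonalityGame (G □ H) (D ∘ Prod.snd) := by
  rw [winsGonalityGame_iff] at h ⊢
  rintro ⟨a₀, b₀⟩
  obtain ⟨f, hf⟩ := h b₀
  refine ⟨f ∘ Prod.snd, fun ⟨a, b⟩ => le_trans ?_ ((hf b).trans_eq ?_)⟩
  · simp only [Prod.mk.injEq]
    split_ifs <;> simp_all
  · simp [chipLaplacian_boxProd, chipLaplacian_const]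

end BoxProd

section Cycle

theorem sum_cycleGraph_adj {n : ℕ} (φ : Fin (n + 3) → ℤ) (v : Fin (n + 3)) :
    ∑ w, (if (cycleGraph (n + 3)).Adj v w then φ w else 0) = φ (v - 1) + φ (v + 1) := by
  have hne : v - 1 ≠ v + 1 := by
    intro h
    have h₁ := congrArg Fin.val h
    rw [Fin.coe_sub_one, Fin.val_add_one] at h₁
    simp only [Fin.ext_iff, Fin.val_last, Fin.val_zero] at h₁
    split_ifs at h₁ <;> lia
  rw [← Finset.sum_filter, ← Finset.sum_pair hne]
  congr 1
  ext w
  rw [← cycleGraph_neighborFinset]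
  simp

theorem chipLaplacian_cycleGraph {n : ℕ} (f : Fin (n + 3) → ℤ) (v : Fin (n + 3)) :
    chipLaplacian (cycleGraph (n + 3)) f v = (f v - f (v - 1)) + (f v - f (v + 1)) := by
  rw [← sum_cycleGraph_adj fun w => f v - f w, chipLaplacian]
  congr!

open Classical in
theorem edgeBoundaryCount_cycleGraph {n : ℕ} (S : Set (Fin (n + 3))) :
    edgeBoundaryCount (cycleGraph (n + 3)) S =
      ∑ v, (if v ∈ S ∧ v - 1 ∉ S then 1 else 0) + ∑ v, (if v ∈ S ∧ v + 1 ∉ S then 1 else 0) := by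
  rw [edgeBoundaryCount, ← Finset.sum_add_distrib]
  refine Finset.sum_congr rfl fun v _ => ?_
  rw [← sum_cycleGraph_adj fun w => if v ∈ S ∧ w ∉ S then 1 else 0]
  congr!

theorem cycleGraph_adj_add_one {n : ℕ} (v : Fin (n + 3)) :
    (cycleGraph (n + 3)).Adj v (v + 1) := by
  rw [cycleGraph_adj]
  right
  abel

/-- Two chips on one vertex of a cycle win the gonality game. -/
theorem winsGonalityGame_cycleGraph (n : ℕ) :
    WinsGonalityGame (cycleGraph (n + 3)) (Pi.single 0 2) := by
  classical
  rw [winsGonalityGame_iff]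
  intro q
  refine ⟨fun j => -min (min (j : ℤ) (n + 3 - j)) (min (q : ℤ) (n + 3 - q)), fun v => ?_⟩
  rw [chipLaplacian_cycleGraph, Fin.coe_sub_one, Fin.val_add_one, Pi.single_apply]
  simp only [Fin.ext_iff, Fin.val_last, Fin.val_zero]
  have hv := v.isLt
  have hq := q.isLt
  split_ifs <;> lia

open Fin.CommRing in
theorem two_le_edgeBoundaryCount_cycleGraph {n : ℕ} {S : Set (Fin (n + 3))} {a b : Fin (n + 3)}
    (ha : a ∈ S) (hb : b ∉ S) : 2 ≤ edgeBoundaryCount (cycleGraph (n + 3)) S := by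
  classical
  have key : ∀ (T : Set (Fin (n + 3))) (a b : Fin (n + 3)), a ∈ T → b ∉ T →
      ∃ i ∈ T, i + 1 ∉ T := by
    intro T a b ha hb
    by_contra! h
    have : ∀ k : ℕ, a + (k : Fin (n + 3)) ∈ T := fun k => by
      induction k with
      | zero => simpa using ha
      | succ k ih =>
        rw [Nat.cast_succ, ← add_assoc]
        exact h _ ih
    apply hb
    have h₁ := this (b - a).val
    rwa [Fin.cast_val_eq_self, add_sub_cancel] at h₁
  obtain ⟨i, hi, hi'⟩ := key S a b ha hb
  obtain ⟨j, hj, hj'⟩ := key Sᶜ b a hb (by simpa using ha)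
  simp only [Set.mem_compl_iff, not_not] at hj hj'
  rw [edgeBoundaryCount_cycleGraph]
  have h₁ : (1 : ℤ) ≤ ∑ v, if v ∈ S ∧ v - 1 ∉ S then 1 else 0 := by
    refine le_trans (by simp [hj, hj'])
      (Finset.single_le_sum (fun v _ => ?_) (Finset.mem_univ (j + 1)))
    split_ifs <;> simp
  have h₂ : (1 : ℤ) ≤ ∑ v, if v ∈ S ∧ v + 1 ∉ S then 1 else 0 := by
    refine le_trans (by simp [hi, hi']) (Finset.single_le_sum (fun v _ => ?_) (Finset.mem_univ i))
    split_ifs <;> simp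
  lia

theorem edgeBoundaryCount_nonneg {V : Type*} [Fintype V] (G : SimpleGraph V) (S : Set V) :
    0 ≤ edgeBoundaryCount G S := by
  classical
  refine Finset.sum_nonneg fun v _ => Finset.sum_nonneg fun w _ => ?_
  split_ifs <;> simp

open Fin.CommRing in
/-- A cycle with one vertex removed is connected. -/
theorem exists_cycleGraph_adj_of_ne {n : ℕ} {S : Set (Fin (n + 3))} {c a b : Fin (n + 3)}
    (ha : a ∈ S) (hac : a ≠ c) (hb : b ∉ S) (hbc : b ≠ c) :
    ∃ x ∈ S, x ≠ c ∧ ∃ y ∉ S, y ≠ c ∧ (cycleGraph (n + 3)).Adj x y := by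
  by_contra! h
  have hne : ∀ k : ℕ, k + 1 < n + 3 → c + ((k + 1 : ℕ) : Fin (n + 3)) ≠ c := by
    intro k hk h
    rw [add_eq_left, Fin.natCast_eq_zero] at h
    exact absurd (Nat.le_of_dvd (by lia) h) (by lia)
  have step : ∀ k : ℕ, k + 1 < n + 3 → (c + ((k + 1 : ℕ) : Fin (n + 3)) ∈ S ↔ c + 1 ∈ S) := by
    intro k
    induction k with
    | zero => simp
    | succ k ih =>
      intro hk
      rw [← ih (by lia)]
      have h₁ := hne k (by lia)
      have h₂ := hne (k + 1) hk
      have h₃ := cycleGraph_adj_add_one (c + ((k + 1 : ℕ) : Fin (n + 3)))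
      rw [add_assoc, ← Nat.cast_succ] at h₃
      constructor
      · intro h₄
        by_contra h₅
        exact h _ h₄ h₂ _ h₅ h₁ h₃.symm
      · intro h₄
        by_contra h₅
        exact h _ h₄ h₁ _ h₅ h₂ h₃
  have all : ∀ x, x ≠ c → (x ∈ S ↔ c + 1 ∈ S) := by
    intro x hx
    have h₁ : (x - c).val ≠ 0 := fun h => hx (sub_eq_zero.1 (Fin.ext h))
    obtain ⟨k, hk⟩ := Nat.exists_eq_succ_of_ne_zero h₁
    have h₂ := step k (by have := (x - c).isLt; lia)
    have h₃ := Fin.cast_val_eq_self (x - c)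
    rw [hk] at h₃
    rw [h₃, add_sub_cancel] at h₂
    exact h₂
  exact hb ((all b hbc).2 ((all a hac).1 ha))

end Cycle

section Torus

theorem exists_winsGonalityGame_toroidalGrid_left (m n : ℕ) :
    ∃ D : Fin (m + 3) × Fin (n + 3) → ℤ, (∀ v, 0 ≤ D v) ∧ ∑ v, D v = (2 * (m + 3) : ℕ) ∧
      WinsGonalityGame (toroidalGrid (m + 3) (n + 3)) D := by
  refine ⟨Pi.single 0 2 ∘ Prod.snd, fun v => ?_, ?_, (winsGonalityGame_cycleGraph n).comp_snd _ _⟩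
  · exact (Pi.single_nonneg.2 (by norm_num) : (0 : Fin (n + 3) → ℤ) ≤ Pi.single 0 2) _
  · simp [Fintype.sum_prod_type, mul_comm]

theorem exists_winsGonalityGame_toroidalGrid_right (m n : ℕ) :
    ∃ D : Fin (m + 3) × Fin (n + 3) → ℤ, (∀ v, 0 ≤ D v) ∧ ∑ v, D v = (2 * (n + 3) : ℕ) ∧
      WinsGonalityGame (toroidalGrid (m + 3) (n + 3)) D := by
  refine ⟨Pi.single 0 2 ∘ Prod.fst, fun v => ?_, ?_, (winsGonalityGame_cycleGraph m).comp_fst _ _⟩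
  · exact (Pi.single_nonneg.2 (by norm_num) : (0 : Fin (m + 3) → ℤ) ≤ Pi.single 0 2) _
  · simp [Fintype.sum_prod_type_right, mul_comm]

/-- If a full row and a full column lie on one side of a cut, and a column minus a vertex lies on
the other side, then the cut has at least `2 * (m + 3)` edges. -/
theorem le_edgeBoundaryCount_of_row_column {m n : ℕ} (U : Set (Fin (m + 3) × Fin (n + 3)))
    (p : Prop) {r i₀ : Fin (m + 3)} {c j₀ : Fin (n + 3)} (hr : ∀ j, (r, j) ∈ U ↔ p)
    (hc : ∀ i, (i, c) ∈ U ↔ p) (h : ∀ i ≠ i₀, (i, j₀) ∈ U ↔ ¬ p) :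
    2 * ((m + 3 : ℕ) : ℤ) ≤ edgeBoundaryCount (toroidalGrid (m + 3) (n + 3)) U := by
  classical
  have two_le : ∀ {k : ℕ} {S : Set (Fin (k + 3))} {a b : Fin (k + 3)}, (a ∈ S ↔ p) → (b ∈ S ↔ ¬ p) →
      2 ≤ edgeBoundaryCount (cycleGraph (k + 3)) S := by
    intro k S a b ha hb
    by_cases hp : p
    · exact two_le_edgeBoundaryCount_cycleGraph (ha.2 hp) (fun hbS => hb.1 hbS hp)
    · exact two_le_edgeBoundaryCount_cycleGraph (hb.2 hp) (fun haS => hp (ha.1 haS))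
  rw [toroidalGrid, edgeBoundaryCount_boxProd]
  obtain ⟨i₁, hi₁⟩ := exists_ne i₀
  have h₁ : 2 ≤ ∑ j, edgeBoundaryCount (cycleGraph (m + 3)) {i | (i, j) ∈ U} :=
    (two_le (S := {i | (i, j₀) ∈ U}) (hr j₀) (h i₁ hi₁)).trans
      (Finset.single_le_sum (f := fun j => edgeBoundaryCount (cycleGraph (m + 3)) {i | (i, j) ∈ U})
        (fun j _ => edgeBoundaryCount_nonneg _ _) (Finset.mem_univ j₀))
  have h₂ : ∑ i : Fin (m + 3), (if i = i₀ then (0 : ℤ) else 2) ≤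
      ∑ i, edgeBoundaryCount (cycleGraph (n + 3)) {j | (i, j) ∈ U} := by
    refine Finset.sum_le_sum fun i _ => ?_
    split_ifs with hi
    · exact edgeBoundaryCount_nonneg _ _
    · exact two_le (S := {j | (i, j) ∈ U}) (hc i) (h i hi)
  have h₃ : ∑ i : Fin (m + 3), (if i = i₀ then (0 : ℤ) else 2) = 2 * (m + 2) := by
    have : ∀ i : Fin (m + 3), (if i = i₀ then (0 : ℤ) else 2) = 2 - if i = i₀ then 2 else 0 := by
      intro i
      split_ifs <;> simp
    simp only [this, Finset.sum_sub_distrib]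
    simp
    ring
  push_cast
  lia

/-- The column `e.2` of the torus with the vertex in row `e.1` removed. -/
def puncturedColumn {m n : ℕ} (e : Fin m × Fin n) : Set (Fin m × Fin n) :=
  {v | v.1 ≠ e.1 ∧ v.2 = e.2}

theorem le_edgeBoundaryCount_of_separates {m n : ℕ} (U : Set (Fin (m + 3) × Fin (n + 3)))
    (e e' : Fin (m + 3) × Fin (n + 3)) (he : puncturedColumn e ⊆ U)
    (he' : Disjoint (puncturedColumn e') U) :
    ((2 * min (m + 3) (n + 3) : ℕ) : ℤ) ≤
      edgeBoundaryCount (toroidalGrid (m + 3) (n + 3)) U := by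
  classical
  have sum_le : ∀ {k l : ℕ} (S : Fin (k + 3) → Set (Fin (l + 3))),
      (¬ ∃ i, ∃ p : Prop, ∀ j, j ∈ S i ↔ p) →
      2 * ((k + 3 : ℕ) : ℤ) ≤ ∑ i, edgeBoundaryCount (cycleGraph (l + 3)) (S i) := by
    intro k l S hS
    have : ∀ i ∈ Finset.univ, 2 ≤ edgeBoundaryCount (cycleGraph (l + 3)) (S i) := by
      intro i _
      have h₁ : ∃ a, a ∈ S i := by
        by_contra! h
        exact hS ⟨i, False, fun j => by simp [h j]⟩
      have h₂ : ∃ b, b ∉ S i := by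
        by_contra! h
        exact hS ⟨i, True, fun j => by simp [h j]⟩
      obtain ⟨a, ha⟩ := h₁
      obtain ⟨b, hb⟩ := h₂
      exact two_le_edgeBoundaryCount_cycleGraph ha hb
    have := Finset.card_nsmul_le_sum _ _ _ this
    rw [Finset.card_univ, Fintype.card_fin, nsmul_eq_mul] at this
    lia
  have hsplit := edgeBoundaryCount_boxProd (cycleGraph (m + 3)) (cycleGraph (n + 3)) U
  have hcols : 0 ≤ ∑ j, edgeBoundaryCount (cycleGraph (m + 3)) {i | (i, j) ∈ U} :=
    Finset.sum_nonneg fun _ _ => edgeBoundaryCount_nonneg _ _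
  have hrows : 0 ≤ ∑ i, edgeBoundaryCount (cycleGraph (n + 3)) {j | (i, j) ∈ U} :=
    Finset.sum_nonneg fun _ _ => edgeBoundaryCount_nonneg _ _
  by_cases hrow : ∃ i, ∃ p : Prop, ∀ j, (i, j) ∈ U ↔ p
  swap
  · have := sum_le (fun i => {j | (i, j) ∈ U}) hrow
    rw [toroidalGrid]
    lia
  by_cases hcol : ∃ j, ∃ p : Prop, ∀ i, (i, j) ∈ U ↔ p
  swap
  · have := sum_le (fun j => {i | (i, j) ∈ U}) hcol
    rw [toroidalGrid]
    lia
  obtain ⟨r, p, hr⟩ := hrow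
  obtain ⟨c, p', hc⟩ := hcol
  have hpp' : p' ↔ p := (hc r).symm.trans (hr c)
  simp only [hpp'] at hc
  suffices h : 2 * ((m + 3 : ℕ) : ℤ) ≤ edgeBoundaryCount (toroidalGrid (m + 3) (n + 3)) U by lia
  by_cases hp : p
  · refine le_edgeBoundaryCount_of_row_column U p hr hc (i₀ := e'.1) (j₀ := e'.2) fun i hi => ?_
    have : (i, e'.2) ∉ U := Set.disjoint_left.1 he' ⟨hi, rfl⟩
    simp [hp, this]
  · refine le_edgeBoundaryCount_of_row_column U p hr hc (i₀ := e.1) (j₀ := e.2) fun i hi => ?_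
    have : (i, e.2) ∈ U := he ⟨hi, rfl⟩
    simp [hp, this]

theorem exists_puncturedColumn_avoids {m n : ℕ} (S : Finset (Fin (m + 3) × Fin (n + 3)))
    (hS : S.card < 2 * (n + 3)) : ∃ e, ∀ v ∈ puncturedColumn e, v ∉ S := by
  obtain ⟨j, -, hj⟩ := Finset.exists_card_fiber_lt_of_card_lt_mul (s := S) (t := Finset.univ)
    (f := Prod.snd) (n := 2) (by simpa [mul_comm] using hS)
  have hj : ({x ∈ S | x.2 = j}).card ≤ 1 := by lia
  rw [Finset.card_le_one_iff_subset_singleton] at hj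
  obtain ⟨x, hx⟩ := hj
  refine ⟨(x.1, j), fun v hv hvS => hv.1 ?_⟩
  have := hx (Finset.mem_filter.2 ⟨hvS, hv.2⟩)
  rw [Finset.mem_singleton.1 this]

theorem le_gonality_toroidalGrid (m n : ℕ) :
    2 * min (m + 3) (n + 3) ≤ gonality (toroidalGrid (m + 3) (n + 3)) := by
  refine le_csInf ⟨_, exists_winsGonalityGame_toroidalGrid_left m n⟩ ?_
  rintro k ⟨D, hD, hk, hwin⟩
  have := hwin.le_degree_of_scramble (toroidalGrid (m + 3) (n + 3)) puncturedColumn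
    (2 * min (m + 3) (n + 3)) ?_ ?_ ?_ le_edgeBoundaryCount_of_separates hD
  · rw [hk] at this
    exact_mod_cast this
  · intro e
    obtain ⟨i, hi⟩ := exists_ne e.1
    exact ⟨(i, e.2), hi, rfl⟩
  · rintro ⟨i₀, j₀⟩ U ⟨⟨a, j⟩, ⟨ha, hj⟩, haU⟩ hsub
    obtain ⟨⟨b, j'⟩, ⟨hb, hj'⟩, hbU⟩ := Set.not_subset.1 hsub
    dsimp only at ha hj hb hj'
    subst hj hj'
    obtain ⟨x, hx, hxc, y, hy, hyc, hxy⟩ :=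
      exists_cycleGraph_adj_of_ne (S := {i | (i, j') ∈ U}) haU ha hbU hb
    exact ⟨(x, j'), ⟨⟨hxc, rfl⟩, hx⟩, (y, j'), ⟨⟨hyc, rfl⟩, hy⟩, boxProd_adj_left.2 hxy⟩
  · intro S hS
    exact exists_puncturedColumn_avoids S (by lia)

end Torus

/-- If `m, n ≥ 3` and `|m − n| ≥ 2`, the divisorial gonality of the toroidal grid
`T_{m,n}` equals `2 · min {m, n}`. -/
theorem toroidalGrid_gonality (m n : ℕ) (hm : 3 ≤ m) (hn : 3 ≤ n)
    (hmn : 2 ≤ ((m : ℤ) - (n : ℤ)).natAbs) :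
    gonality (toroidalGrid m n) = 2 * min m n := by
  obtain ⟨m, rfl⟩ := Nat.exists_eq_add_of_le' hm
  obtain ⟨n, rfl⟩ := Nat.exists_eq_add_of_le' hn
  refine le_antisymm ?_ (le_gonality_toroidalGrid m n)
  have h₁ : gonality (toroidalGrid (m + 3) (n + 3)) ≤ 2 * (m + 3) :=
    Nat.sInf_le (exists_winsGonalityGame_toroidalGrid_left m n)
  have h₂ : gonality (toroidalGrid (m + 3) (n + 3)) ≤ 2 * (n + 3) :=
    Nat.sInf_le (exists_winsGonalityGame_toroidalGrid_right m n)
  exact (le_min h₁ h₂).trans (by lia)
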